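/- Let p be an odd prime, let f : ℤ_p → ℤ_p be everywhere analytic with integral coefficients, and let λ ∈ ℚ_p with ‖λ‖_p > 1. Then the function s ↦ ζ_p^f(s,λ), defined on ℤ_p∖{1} (an open neighborhood of 0 in ℚ_p), is differentiable at s = 0, the Volkenborn integral ∫_{ℤ_p} (λ+f(a))·(log_p(λ+f(a)) − 1) da exists, and log Γ_p^f(λ) := ω_v(λ)·(d/ds ζ_p^f(s,λ))|_{s=0} = ∫_{ℤ_p} (λ+f(a))·(log_p(λ+f(a)) − 1) da. -/

import Mathlib

open Filter Topology

namespace PZeta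

variable (p : ℕ) [Fact p.Prime]

/-- The `N`-th partial sum defining the fermionic integral
`∫_{ℤ_p} g dμ₋₁ = lim_N Σ_{a=0}^{p^N-1} (-1)^a g(a)`. -/
noncomputable def fermSum (g : ℤ_[p] → ℚ_[p]) (N : ℕ) : ℚ_[p] :=
  ∑ a ∈ Finset.range (p ^ N), (-1 : ℚ_[p]) ^ a * g (a : ℤ_[p])

/-- The `N`-th partial sum defining the Volkenborn integral
`∫_{ℤ_p} g da = lim_N p^{-N} Σ_{a=0}^{p^N-1} g(a)`. -/
noncomputable def volkSum (g : ℤ_[p] → ℚ_[p]) (N : ℕ) : ℚ_[p] :=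
  ((p : ℚ_[p]) ^ N)⁻¹ * ∑ a ∈ Finset.range (p ^ N), g (a : ℤ_[p])

/-- The unit part `x·p^{-v_p(x)}` of a nonzero `p`-adic number. -/
noncomputable def unitPart (x : ℚ_[p]) : ℚ_[p] := x * (p : ℚ_[p]) ^ (-x.valuation)

/-- The Teichmüller representative of a `p`-adic unit, `lim_n x^{p^n}`. -/
noncomputable def teich (x : ℚ_[p]) : ℚ_[p] :=
  limUnder atTop fun n : ℕ => x ^ p ^ n

/-- The projection `⟨x⟩ ∈ 1 + pℤ_p`, via `x = p^{v_p(x)}·ζ·⟨x⟩`. -/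
noncomputable def angle (x : ℚ_[p]) : ℚ_[p] := unitPart p x / teich p (unitPart p x)

/-- `ω_v(x) := x / ⟨x⟩ = p^{v_p(x)}·ζ`. -/
noncomputable def omegaV (x : ℚ_[p]) : ℚ_[p] := x / angle p x

/-- The generalized binomial coefficient `C(t,n) = t(t-1)⋯(t-n+1)/n!`. -/
noncomputable def gbinom (t : ℚ_[p]) (n : ℕ) : ℚ_[p] :=
  (∏ i ∈ Finset.range n, (t - (i : ℚ_[p]))) / (n.factorial : ℚ_[p])

/-- The power `y^t` defined by the binomial series `Σ_n C(t,n)(y-1)^n`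
(used for `y ∈ 1 + pℤ_p` and `t ∈ ℤ_p`). -/
noncomputable def bpow (y t : ℚ_[p]) : ℚ_[p] := ∑' n : ℕ, gbinom p t n * (y - 1) ^ n

/-- The Iwasawa `p`-adic logarithm: `log_p x = Σ_{n≥1} (-1)^{n+1}(⟨x⟩-1)^n/n`
(one has `log_p p = 0` and `log_p ζ = 0` for roots of unity of order prime to `p`). -/
noncomputable def padicLog (x : ℚ_[p]) : ℚ_[p] :=
  ∑' n : ℕ, (-1 : ℚ_[p]) ^ n * (angle p x - 1) ^ (n + 1) / ((n : ℚ_[p]) + 1)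

/-- The power `y^t` defined by the exponential series `Σ_n (t·log_p y)^n/n!`
(used for `y ∈ 1 + pℤ_p` and `‖t‖ < p^{(p-2)/(p-1)}`). -/
noncomputable def epow (y t : ℚ_[p]) : ℚ_[p] :=
  ∑' n : ℕ, (t * padicLog p y) ^ n / (n.factorial : ℚ_[p])

/-- `f : ℤ_p → ℤ_p` is everywhere analytic with integral coefficients:
`f(x) = Σ_k c_k x^k` with `‖c_k‖ ≤ 1`, `c_k → 0`. -/
def EverywhereAnalytic (f : ℤ_[p] → ℤ_[p]) : Prop :=
  ∃ c : ℕ → ℚ_[p], (∀ k, ‖c k‖ ≤ 1) ∧ Tendsto c atTop (𝓝 0) ∧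
    ∀ x : ℤ_[p], (f x : ℚ_[p]) = ∑' k : ℕ, c k * (x : ℚ_[p]) ^ k

/-- The `p`-adic Hurwitz-type Euler zeta function w.r.t. `f`:
`ζ_{p,E}^f(s,λ) = ∫_{ℤ_p} ⟨λ+f(a)⟩^{1-s} dμ₋₁(a)`. -/
noncomputable def zetaE (f : ℤ_[p] → ℤ_[p]) (s : ℤ_[p]) (lam : ℚ_[p]) : ℚ_[p] :=
  limUnder atTop
    (fermSum p fun a => bpow p (angle p (lam + (f a : ℚ_[p]))) (1 - (s : ℚ_[p])))

/-- The `p`-adic Hurwitz zeta function w.r.t. `f`: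
`ζ_p^f(s,λ) = (s-1)⁻¹ ∫_{ℤ_p} ⟨λ+f(a)⟩^{1-s} da`. -/
noncomputable def zetaH (f : ℤ_[p] → ℤ_[p]) (s : ℤ_[p]) (lam : ℚ_[p]) : ℚ_[p] :=
  ((s : ℚ_[p]) - 1)⁻¹ *
    limUnder atTop
      (volkSum p fun a => bpow p (angle p (lam + (f a : ℚ_[p]))) (1 - (s : ℚ_[p])))

end PZeta

open PZeta

namespace PZeta

section Calculus

variable {p : ℕ} [Fact p.Prime]

/-- `g'` is a derivative of `g : ℤ_p → ℚ_p`, the values of `g`, those of `g'`, the second-order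
Taylor remainder of `g` and the Lipschitz constant of `g'` all being bounded by `r`. -/
structure C2Bound (g g' : ℤ_[p] → ℚ_[p]) (r : ℝ) : Prop where
  norm_le : ∀ x, ‖g x‖ ≤ r
  norm_deriv_le : ∀ x, ‖g' x‖ ≤ r
  norm_taylor_le : ∀ x h : ℤ_[p], ‖g (x + h) - g x - h * g' x‖ ≤ r * ‖h‖ ^ 2
  norm_deriv_sub_le : ∀ x h : ℤ_[p], ‖g' (x + h) - g' x‖ ≤ r * ‖h‖

lemma norm_add_le_of_le {a b : ℚ_[p]} {r : ℝ} (ha : ‖a‖ ≤ r) (hb : ‖b‖ ≤ r) : ‖a + b‖ ≤ r :=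
  (IsUltrametricDist.norm_add_le_max a b).trans (max_le ha hb)

lemma norm_sub_le_of_le {a b : ℚ_[p]} {r : ℝ} (ha : ‖a‖ ≤ r) (hb : ‖b‖ ≤ r) : ‖a - b‖ ≤ r := by
  rw [sub_eq_add_neg]
  exact norm_add_le_of_le ha (by rwa [norm_neg])

lemma norm_mul_le_of_le_of_le {a b : ℚ_[p]} {r s : ℝ} (ha : ‖a‖ ≤ r) (hb : ‖b‖ ≤ s) :
    ‖a * b‖ ≤ r * s := by
  rw [norm_mul]
  exact mul_le_mul ha hb (norm_nonneg _) ((norm_nonneg _).trans ha)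

namespace C2Bound

variable {g g' k k' : ℤ_[p] → ℚ_[p]} {r s : ℝ}

lemma nonneg (hg : C2Bound g g' r) : 0 ≤ r := (norm_nonneg _).trans (hg.norm_le 0)

lemma mono (hg : C2Bound g g' r) (h : r ≤ s) : C2Bound g g' s where
  norm_le x := (hg.norm_le x).trans h
  norm_deriv_le x := (hg.norm_deriv_le x).trans h
  norm_taylor_le x y := (hg.norm_taylor_le x y).trans (by gcongr)
  norm_deriv_sub_le x y := (hg.norm_deriv_sub_le x y).trans (by gcongr)

lemma const (c : ℚ_[p]) : C2Bound (fun _ : ℤ_[p] => c) (fun _ => 0) ‖c‖ where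
  norm_le x := le_rfl
  norm_deriv_le x := by simp
  norm_taylor_le x h := by
    simp only [sub_self, mul_zero, norm_zero]
    positivity
  norm_deriv_sub_le x h := by
    simp only [sub_self, norm_zero]
    positivity

lemma coe : C2Bound (fun x : ℤ_[p] => (x : ℚ_[p])) (fun _ => 1) 1 where
  norm_le x := x.2
  norm_deriv_le x := by simp
  norm_taylor_le x h := by simp
  norm_deriv_sub_le x h := by simp

lemma add (hg : C2Bound g g' r) (hk : C2Bound k k' r) :
    C2Bound (fun x => g x + k x) (fun x => g' x + k' x) r where
  norm_le x := norm_add_le_of_le (hg.norm_le x) (hk.norm_le x)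
  norm_deriv_le x := norm_add_le_of_le (hg.norm_deriv_le x) (hk.norm_deriv_le x)
  norm_taylor_le x h := by
    convert norm_add_le_of_le (hg.norm_taylor_le x h) (hk.norm_taylor_le x h) using 2
    ring
  norm_deriv_sub_le x h := by
    convert norm_add_le_of_le (hg.norm_deriv_sub_le x h) (hk.norm_deriv_sub_le x h) using 2
    ring

lemma norm_sub_le (hg : C2Bound g g' r) (x h : ℤ_[p]) : ‖g (x + h) - g x‖ ≤ r * ‖h‖ := by
  have h1 : ‖h‖ ≤ 1 := h.norm_le_one
  have hr := hg.nonneg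
  have h2 : ‖(h : ℚ_[p]) * g' x‖ ≤ r * ‖h‖ := by
    rw [mul_comm r]
    exact norm_mul_le_of_le_of_le le_rfl (hg.norm_deriv_le x)
  have h3 : ‖g (x + h) - g x - h * g' x‖ ≤ r * ‖h‖ := by
    refine (hg.norm_taylor_le x h).trans ?_
    gcongr
    nlinarith [norm_nonneg h]
  simpa using norm_add_le_of_le h3 h2

lemma mul (hg : C2Bound g g' r) (hk : C2Bound k k' s) :
    C2Bound (fun x => g x * k x) (fun x => g' x * k x + g x * k' x) (r * s) where
  norm_le x := norm_mul_le_of_le_of_le (hg.norm_le x) (hk.norm_le x)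
  norm_deriv_le x := norm_add_le_of_le
    (norm_mul_le_of_le_of_le (hg.norm_deriv_le x) (hk.norm_le x))
    (norm_mul_le_of_le_of_le (hg.norm_le x) (hk.norm_deriv_le x))
  norm_taylor_le x h := by
    have h1 := norm_mul_le_of_le_of_le (hg.norm_sub_le x h) (hk.norm_sub_le x h)
    have h2 := norm_mul_le_of_le_of_le (hg.norm_taylor_le x h) (hk.norm_le x)
    have h3 := norm_mul_le_of_le_of_le (hg.norm_le x) (hk.norm_taylor_le x h)
    have e1 : r * ‖h‖ * (s * ‖h‖) = r * s * ‖h‖ ^ 2 := by ring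
    have e2 : r * ‖h‖ ^ 2 * s = r * s * ‖h‖ ^ 2 := by ring
    rw [e1] at h1
    rw [e2] at h2
    rw [← mul_assoc] at h3
    convert norm_add_le_of_le (norm_add_le_of_le h1 h2) h3 using 2
    ring
  norm_deriv_sub_le x h := by
    have h1 := norm_mul_le_of_le_of_le (hg.norm_deriv_sub_le x h) (hk.norm_le (x + h))
    have h2 := norm_mul_le_of_le_of_le (hg.norm_deriv_le x) (hk.norm_sub_le x h)
    have h3 := norm_mul_le_of_le_of_le (hg.norm_sub_le x h) (hk.norm_deriv_le (x + h))
    have h4 := norm_mul_le_of_le_of_le (hg.norm_le x) (hk.norm_deriv_sub_le x h)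
    rw [mul_right_comm] at h1 h3
    rw [← mul_assoc] at h2 h4
    convert norm_add_le_of_le (norm_add_le_of_le h1 h2) (norm_add_le_of_le h3 h4) using 2
    ring

lemma const_mul (c : ℚ_[p]) (hg : C2Bound g g' r) :
    C2Bound (fun x => c * g x) (fun x => c * g' x) (‖c‖ * r) := by
  simpa using (const c).mul hg

lemma exists_pow (hg : C2Bound g g' r) (n : ℕ) :
    ∃ k' : ℤ_[p] → ℚ_[p], C2Bound (fun x => g x ^ n) k' (r ^ n) := by
  induction n with
  | zero => exact ⟨_, by simpa using const (p := p) 1⟩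
  | succ n ih =>
    obtain ⟨k', hk⟩ := ih
    exact ⟨_, by simpa only [pow_succ] using hk.mul hg⟩

lemma summable_of_norm_le {ι : Type*} {a : ι → ℚ_[p]} {r : ι → ℝ} (h : ∀ i, ‖a i‖ ≤ r i)
    (hr : Tendsto r cofinite (𝓝 0)) : Summable a :=
  NonarchimedeanAddGroup.summable_of_tendsto_cofinite_zero (squeeze_zero_norm h hr)

lemma tsum {g g' : ℕ → ℤ_[p] → ℚ_[p]} {r : ℕ → ℝ} {R : ℝ}
    (hg : ∀ n, C2Bound (g n) (g' n) (r n)) (hr : Tendsto r atTop (𝓝 0)) (hR : ∀ n, r n ≤ R) :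
    C2Bound (fun x => ∑' n, g n x) (fun x => ∑' n, g' n x) R := by
  rw [← Nat.cofinite_eq_atTop] at hr
  have hR' n : C2Bound (g n) (g' n) R := (hg n).mono (hR n)
  have hs x : Summable fun n => g n x := summable_of_norm_le (fun n => (hg n).norm_le x) hr
  have hs' x : Summable fun n => g' n x := summable_of_norm_le (fun n => (hg n).norm_deriv_le x) hr
  refine ⟨fun x => ?_, fun x => ?_, fun x h => ?_, fun x h => ?_⟩
  · exact IsUltrametricDist.norm_tsum_le_of_forall_le fun n => (hR' n).norm_le x
  · exact IsUltrametricDist.norm_tsum_le_of_forall_le fun n => (hR' n).norm_deriv_le x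
  · rw [← tsum_mul_left, ← (hs _).tsum_sub (hs _),
      ← ((hs _).sub (hs _)).tsum_sub ((hs' x).mul_left _)]
    exact IsUltrametricDist.norm_tsum_le_of_forall_le fun n => (hR' n).norm_taylor_le x h
  · rw [← (hs' _).tsum_sub (hs' _)]
    exact IsUltrametricDist.norm_tsum_le_of_forall_le fun n => (hR' n).norm_deriv_sub_le x h

end C2Bound

/-- An everywhere analytic function with integral coefficients has all its second-order data
bounded by `1`. -/
lemma EverywhereAnalytic.exists_c2Bound {f : ℤ_[p] → ℤ_[p]} (hf : EverywhereAnalytic p f) :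
    ∃ f' : ℤ_[p] → ℚ_[p], C2Bound (fun x => (f x : ℚ_[p])) f' 1 := by
  obtain ⟨c, hc1, hc0, hf⟩ := hf
  choose k' hk using fun n => (C2Bound.coe (p := p)).exists_pow n
  simp only [one_pow] at hk
  simp only [hf]
  refine ⟨_, C2Bound.tsum (r := fun n => ‖c n‖ * 1) (fun n => (hk n).const_mul (c n)) ?_
    (by simpa using hc1)⟩
  simpa using hc0.norm

section Volkenborn

lemma sum_range_mul_eq {M : Type*} [AddCommMonoid M] (F : ℕ → M) (m n : ℕ) :
    ∑ a ∈ Finset.range (m * n), F a =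
      ∑ j ∈ Finset.range n, ∑ b ∈ Finset.range m, F (b + m * j) := by
  induction n with
  | zero => simp
  | succ n ih =>
    rw [Nat.mul_succ, Finset.sum_range_add, ih, Finset.sum_range_succ]
    simp only [add_comm]

lemma norm_sum_deriv_le {g g' : ℤ_[p] → ℚ_[p]} {r : ℝ} (hg : C2Bound g g' r) (N : ℕ) :
    ‖∑ a ∈ Finset.range (p ^ N), g' (a : ℤ_[p])‖ ≤ r * (p * ((p : ℝ) ^ N)⁻¹) := by
  have hp : (1 : ℝ) ≤ p := by exact_mod_cast (Fact.out : p.Prime).one_lt.le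
  have hp0 : (p : ℝ) ≠ 0 := by positivity
  have hr := hg.nonneg
  induction N with
  | zero =>
    simp only [pow_zero, Finset.sum_range_one, inv_one, mul_one, Nat.cast_zero]
    exact (hg.norm_deriv_le 0).trans (le_mul_of_one_le_right hr hp)
  | succ N ih =>
    rw [pow_succ, sum_range_mul_eq]
    have e : ∑ j ∈ Finset.range p, ∑ b ∈ Finset.range (p ^ N),
          g' ((b + p ^ N * j : ℕ) : ℤ_[p]) =
        (∑ j ∈ Finset.range p, ∑ b ∈ Finset.range (p ^ N),
          (g' ((b : ℤ_[p]) + (p : ℤ_[p]) ^ N * j) - g' b)) +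
        p * ∑ b ∈ Finset.range (p ^ N), g' (b : ℤ_[p]) := by
      simp [Finset.sum_sub_distrib]
    have hb : r * (p * ((p : ℝ) ^ (N + 1))⁻¹) = r * ((p : ℝ) ^ N)⁻¹ := by
      rw [pow_succ]
      field_simp
    rw [e, hb]
    refine norm_add_le_of_le ?_ ?_
    · refine IsUltrametricDist.norm_sum_le_of_forall_le_of_nonneg (by positivity) fun j _ =>
        IsUltrametricDist.norm_sum_le_of_forall_le_of_nonneg (by positivity) fun b _ => ?_
      refine (hg.norm_deriv_sub_le _ _).trans ?_
      gcongr
      rw [norm_mul, norm_pow, PadicInt.norm_p, inv_pow]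
      exact mul_le_of_le_one_right (by positivity) (PadicInt.norm_le_one _)
    · rw [norm_mul, Padic.norm_p]
      calc (p : ℝ)⁻¹ * _ ≤ (p : ℝ)⁻¹ * (r * (p * ((p : ℝ) ^ N)⁻¹)) := by gcongr
        _ = _ := by field_simp

lemma norm_volkSum_succ_sub_le (hp : Odd p) {g g' : ℤ_[p] → ℚ_[p]} {r : ℝ}
    (hg : C2Bound g g' r) (N : ℕ) :
    ‖volkSum p g (N + 1) - volkSum p g N‖ ≤ r * p * ((p : ℝ)⁻¹) ^ N := by
  have hp1 : (1 : ℝ) ≤ p := by exact_mod_cast (Fact.out : p.Prime).one_lt.le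
  have hp0 : (p : ℚ_[p]) ≠ 0 := by exact_mod_cast (Fact.out : p.Prime).ne_zero
  have hr := hg.nonneg
  obtain ⟨m, hm⟩ := hp
  have hsum : (∑ j ∈ Finset.range p, (j : ℚ_[p])) = p * m := by
    have h := Finset.sum_range_id_mul_two p
    have h2 : (∑ j ∈ Finset.range p, j) = p * m := by
      apply Nat.eq_of_mul_eq_mul_right two_pos
      rw [h, hm]
      simp only [Nat.add_sub_cancel]
      ring
    rw [← Nat.cast_sum, h2, Nat.cast_mul]
  have e : volkSum p g (N + 1) - volkSum p g N =
      ((p : ℚ_[p]) ^ (N + 1))⁻¹ * (∑ j ∈ Finset.range p, ∑ b ∈ Finset.range (p ^ N),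
        (g ((b : ℤ_[p]) + (p : ℤ_[p]) ^ N * j) - g b -
          ((p : ℤ_[p]) ^ N * j : ℤ_[p]) * g' b)) +
      m * ∑ b ∈ Finset.range (p ^ N), g' (b : ℤ_[p]) := by
    have e2 : ∑ j ∈ Finset.range p, ∑ b ∈ Finset.range (p ^ N),
        ((p : ℤ_[p]) ^ N * j : ℤ_[p]) * g' b =
        (p : ℚ_[p]) ^ (N + 1) * (m * ∑ b ∈ Finset.range (p ^ N), g' (b : ℤ_[p])) := by
      push_cast
      simp only [← Finset.mul_sum, ← Finset.sum_mul, hsum]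
      ring
    simp only [volkSum]
    rw [show p ^ (N + 1) = p ^ N * p from pow_succ _ _, sum_range_mul_eq]
    simp only [Finset.sum_sub_distrib, e2]
    rw [mul_sub, inv_mul_cancel_left₀ (pow_ne_zero _ hp0)]
    simp only [Finset.sum_const, Finset.card_range, nsmul_eq_mul]
    push_cast
    field_simp
    ring
  rw [e]
  refine norm_add_le_of_le ?_ ?_
  · have h : ‖∑ j ∈ Finset.range p, ∑ b ∈ Finset.range (p ^ N),
        (g ((b : ℤ_[p]) + (p : ℤ_[p]) ^ N * j) - g b -
          ((p : ℤ_[p]) ^ N * j : ℤ_[p]) * g' b)‖ ≤ r * (((p : ℝ)⁻¹) ^ N) ^ 2 := by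
      refine IsUltrametricDist.norm_sum_le_of_forall_le_of_nonneg (by positivity) fun j _ =>
        IsUltrametricDist.norm_sum_le_of_forall_le_of_nonneg (by positivity) fun b _ => ?_
      refine (hg.norm_taylor_le _ _).trans ?_
      gcongr
      rw [norm_mul, norm_pow, PadicInt.norm_p]
      exact mul_le_of_le_one_right (by positivity) (PadicInt.norm_le_one _)
    rw [norm_mul, norm_inv, norm_pow, Padic.norm_p]
    refine (mul_le_mul_of_nonneg_left h (by positivity)).trans_eq ?_
    simp only [inv_pow, inv_inv]
    field_simp
    ring
  · rw [norm_mul]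
    refine (mul_le_of_le_one_left (norm_nonneg _) ?_).trans
      ((norm_sum_deriv_le hg N).trans_eq (by rw [inv_pow]; ring))
    exact_mod_cast Padic.norm_int_le_one (m : ℤ)

lemma exists_volkSum_limit (hp : Odd p) {g g' : ℤ_[p] → ℚ_[p]} {r : ℝ} (hg : C2Bound g g' r) :
    ∃ V : ℚ_[p], ‖V‖ ≤ r * p ∧ ∀ N, ‖volkSum p g N - V‖ ≤ r * p * ((p : ℝ)⁻¹) ^ N := by
  have hp1 : (1 : ℝ) < p := by exact_mod_cast (Fact.out : p.Prime).one_lt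
  have hr := hg.nonneg
  have hpi : (p : ℝ)⁻¹ < 1 := inv_lt_one_of_one_lt₀ hp1
  have hstep := norm_volkSum_succ_sub_le hp hg
  obtain ⟨V, hV⟩ := cauchySeq_tendsto_of_complete (cauchySeq_of_le_geometric (f := volkSum p g)
    (p : ℝ)⁻¹ (r * p) hpi fun N => by rw [dist_comm, dist_eq_norm]; exact hstep N)
  have hdiff N k : ‖volkSum p g (N + k) - volkSum p g N‖ ≤ r * p * ((p : ℝ)⁻¹) ^ N := by
    induction k with
    | zero => simp only [add_zero, sub_self, norm_zero]; positivity
    | succ k ih =>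
      have h := hstep (N + k)
      have h2 : r * p * ((p : ℝ)⁻¹) ^ (N + k) ≤ r * p * ((p : ℝ)⁻¹) ^ N :=
        mul_le_mul_of_nonneg_left
          (pow_le_pow_of_le_one (by positivity) hpi.le (Nat.le_add_right _ _)) (by positivity)
      simpa [← add_assoc] using norm_add_le_of_le (h.trans h2) ih
  have hlim N : ‖volkSum p g N - V‖ ≤ r * p * ((p : ℝ)⁻¹) ^ N := by
    rw [norm_sub_rev]
    refine le_of_tendsto (((tendsto_add_atTop_iff_nat N).2 hV).sub_const _).norm
      (Eventually.of_forall fun k => ?_)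
    rw [add_comm]
    exact hdiff N k
  refine ⟨V, ?_, hlim⟩
  have h0 := hlim 0
  have h1 : ‖volkSum p g 0‖ ≤ r * p := by
    simp only [volkSum, pow_zero, inv_one, one_mul, Finset.sum_range_one, Nat.cast_zero]
    exact (hg.norm_le 0).trans (le_mul_of_one_le_right hr hp1.le)
  rw [pow_zero, mul_one] at h0
  simpa using norm_sub_le_of_le h1 h0

/-- Volkenborn integration commutes with suitably convergent sums. -/
lemma tendsto_volkSum_tsum {g g' : ℕ → ℤ_[p] → ℚ_[p]} {r : ℕ → ℝ} {V : ℕ → ℚ_[p]} {R : ℝ}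
    (hg : ∀ n, C2Bound (g n) (g' n) (r n))
    (hV : ∀ n N, ‖volkSum p (g n) N - V n‖ ≤ r n * p * ((p : ℝ)⁻¹) ^ N)
    (hVn : ∀ n, ‖V n‖ ≤ r n * p) (c : ℕ → ℚ_[p])
    (hc : Tendsto (fun n => ‖c n‖ * r n) atTop (𝓝 0)) (hR : ∀ n, ‖c n‖ * r n ≤ R) :
    Tendsto (volkSum p fun a => ∑' n, c n * g n a) atTop (𝓝 (∑' n, c n * V n)) := by
  have hp1 : (1 : ℝ) < p := by exact_mod_cast (Fact.out : p.Prime).one_lt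
  have hpi : (p : ℝ)⁻¹ < 1 := inv_lt_one_of_one_lt₀ hp1
  rw [← Nat.cofinite_eq_atTop] at hc
  have hs a : Summable fun n => c n * g n a :=
    C2Bound.summable_of_norm_le (fun n => norm_mul_le_of_le_of_le le_rfl ((hg n).norm_le a)) hc
  have hsV : Summable fun n => c n * V n := by
    refine C2Bound.summable_of_norm_le (fun n => norm_mul_le_of_le_of_le le_rfl (hVn n)) ?_
    simpa [mul_assoc] using hc.mul_const (p : ℝ)
  have hsN N : HasSum (fun n => c n * volkSum p (g n) N)
      (volkSum p (fun a => ∑' n, c n * g n a) N) := by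
    have h : HasSum (fun n => ∑ a ∈ Finset.range (p ^ N), c n * g n (a : ℤ_[p]))
        (∑ a ∈ Finset.range (p ^ N), ∑' n, c n * g n (a : ℤ_[p])) :=
      hasSum_sum fun a _ => (hs a).hasSum
    have e : (fun n => c n * volkSum p (g n) N) = fun n => ((p : ℚ_[p]) ^ N)⁻¹ *
        ∑ a ∈ Finset.range (p ^ N), c n * g n (a : ℤ_[p]) :=
      funext fun n => by rw [volkSum, ← Finset.mul_sum, mul_left_comm]
    rw [e]
    exact h.mul_left _
  rw [tendsto_iff_norm_sub_tendsto_zero]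
  have hlim : Tendsto (fun N : ℕ => R * p * ((p : ℝ)⁻¹) ^ N) atTop (𝓝 0) := by
    simpa using (tendsto_pow_atTop_nhds_zero_of_lt_one (by positivity) hpi).const_mul (R * p)
  refine squeeze_zero (fun _ => norm_nonneg _) (fun N => ?_) hlim
  rw [← (hsN N).tsum_eq, ← (hsN N).summable.tsum_sub hsV]
  refine IsUltrametricDist.norm_tsum_le_of_forall_le fun n => ?_
  rw [← mul_sub]
  calc _ ≤ ‖c n‖ * (r n * p * ((p : ℝ)⁻¹) ^ N) := norm_mul_le_of_le_of_le le_rfl (hV n N)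
    _ = (‖c n‖ * r n) * (p * ((p : ℝ)⁻¹) ^ N) := by ring
    _ ≤ R * (p * ((p : ℝ)⁻¹) ^ N) := by gcongr; exact hR n
    _ = _ := by ring

end Volkenborn

section Angle

lemma norm_le_inv_of_lt_one {x : ℚ_[p]} (hx : ‖x‖ < 1) : ‖x‖ ≤ (p : ℝ)⁻¹ := by
  obtain ⟨y, hy⟩ := (PadicInt.norm_lt_one_iff_dvd (⟨x, hx.le⟩ : ℤ_[p])).1 hx
  have e : ‖x‖ = ‖(p : ℤ_[p]) * y‖ := by rw [← hy]; rfl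
  rw [e, norm_mul, PadicInt.norm_p]
  exact mul_le_of_le_one_right (by positivity) y.norm_le_one

lemma dvd_pow_prime_sub_self (u : ℤ_[p]) : (p : ℤ_[p]) ∣ u ^ p - u := by
  rw [← Ideal.mem_span_singleton, ← PadicInt.maximalIdeal_eq_span_p, ← PadicInt.ker_toZMod,
    RingHom.mem_ker, map_sub, map_pow, ZMod.pow_card, sub_self]

lemma norm_pow_sub_pow_le {u w : ℤ_[p]} (h : (p : ℤ_[p]) ∣ u - w) (n : ℕ) :
    ‖u ^ p ^ n - w ^ p ^ n‖ ≤ (p : ℝ)⁻¹ * (p : ℝ)⁻¹ ^ n := by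
  obtain ⟨y, hy⟩ := dvd_sub_pow_of_dvd_sub h n
  rw [hy, norm_mul, norm_pow, PadicInt.norm_p, pow_succ']
  exact mul_le_of_le_one_right (by positivity) y.norm_le_one

lemma prime_inv_lt_one : (p : ℝ)⁻¹ < 1 :=
  inv_lt_one_of_one_lt₀ (by exact_mod_cast (Fact.out : p.Prime).one_lt)

lemma tendsto_pow_prime_pow_one {w : ℤ_[p]} (h : (p : ℤ_[p]) ∣ w - 1) :
    Tendsto (fun n : ℕ => w ^ p ^ n) atTop (𝓝 1) := by
  have hlim : Tendsto (fun n : ℕ => (p : ℝ)⁻¹ * (p : ℝ)⁻¹ ^ n) atTop (𝓝 0) := by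
    simpa using (tendsto_pow_atTop_nhds_zero_of_lt_one (by positivity)
      (prime_inv_lt_one (p := p))).const_mul (p : ℝ)⁻¹
  rw [tendsto_iff_norm_sub_tendsto_zero]
  exact squeeze_zero (fun _ => norm_nonneg _)
    (fun n => by simpa using norm_pow_sub_pow_le h n) hlim

lemma exists_tendsto_pow_prime_pow (u : ℤ_[p]) :
    ∃ t : ℤ_[p], Tendsto (fun n : ℕ => u ^ p ^ n) atTop (𝓝 t) ∧ ‖t - u‖ ≤ (p : ℝ)⁻¹ := by
  have hstep n : ‖u ^ p ^ (n + 1) - u ^ p ^ n‖ ≤ (p : ℝ)⁻¹ * (p : ℝ)⁻¹ ^ n := by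
    simpa only [← pow_mul, ← pow_succ'] using norm_pow_sub_pow_le (dvd_pow_prime_sub_self u) n
  obtain ⟨t, ht⟩ := cauchySeq_tendsto_of_complete (cauchySeq_of_le_geometric
    (f := fun n : ℕ => u ^ p ^ n) (p : ℝ)⁻¹ (p : ℝ)⁻¹ prime_inv_lt_one
    fun n => by rw [dist_comm, dist_eq_norm]; exact hstep n)
  refine ⟨t, ht, le_of_tendsto (ht.sub_const u).norm (Eventually.of_forall fun n => ?_)⟩
  induction n with
  | zero => simp
  | succ n ih =>
    have h := (hstep n).trans (mul_le_of_le_one_right (by positivity)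
      (pow_le_one₀ (by positivity) (prime_inv_lt_one (p := p)).le))
    have := (IsUltrametricDist.norm_add_le_max _ _).trans (max_le h ih)
    simpa using this

lemma teich_coe {u t : ℤ_[p]} (h : Tendsto (fun n : ℕ => u ^ p ^ n) atTop (𝓝 t)) :
    teich p (u : ℚ_[p]) = t := by
  refine Tendsto.limUnder_eq ?_
  have h' : Tendsto (fun n : ℕ => ((u ^ p ^ n : ℤ_[p]) : ℚ_[p])) atTop (𝓝 t) :=
    (continuous_subtype_val.tendsto t).comp h
  simpa only [PadicInt.coe_pow] using h'

lemma norm_unitPart {x : ℚ_[p]} (hx : x ≠ 0) : ‖unitPart p x‖ = 1 := by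
  have hp0 : (p : ℝ) ≠ 0 := by exact_mod_cast (Fact.out : p.Prime).ne_zero
  rw [unitPart, norm_mul, Padic.norm_p_zpow, Padic.norm_eq_zpow_neg_valuation hx,
    ← zpow_add₀ hp0]
  simp

lemma exists_coe_eq_unitPart {x : ℚ_[p]} (hx : x ≠ 0) : ∃ u : ℤ_[p], (u : ℚ_[p]) = unitPart p x :=
  ⟨⟨unitPart p x, (norm_unitPart hx).le⟩, rfl⟩

/-- `⟨x w⟩ = ⟨x⟩ w` for `w ∈ 1 + pℤ_p`. -/
lemma angle_mul {x : ℚ_[p]} (hx : x ≠ 0) {w : ℤ_[p]} (hw : (p : ℤ_[p]) ∣ w - 1) :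
    angle p (x * w) = angle p x * w := by
  have hw1 : ‖w‖ = 1 := by
    have h := (PadicInt.norm_lt_one_iff_dvd _).2 hw
    rw [← norm_one (α := ℤ_[p]), ← norm_neg (1 : ℤ_[p])]
    refine PadicInt.norm_eq_of_norm_add_lt_right ?_
    rwa [← sub_eq_add_neg, norm_neg, norm_one]
  have hw0 : (w : ℚ_[p]) ≠ 0 := by
    rw [← norm_ne_zero_iff, ← PadicInt.norm_def, hw1]
    exact one_ne_zero
  have hval : (w : ℚ_[p]).valuation = 0 := by
    have h := Padic.norm_eq_zpow_neg_valuation hw0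
    rw [← PadicInt.norm_def, hw1, eq_comm, zpow_eq_one_iff_right₀ (Nat.cast_nonneg p)
      (by exact_mod_cast (Fact.out : p.Prime).ne_one)] at h
    exact neg_eq_zero.1 h
  have hunit : unitPart p (x * w) = unitPart p x * w := by
    simp only [unitPart, Padic.valuation_mul hx hw0, hval, add_zero]
    ring
  obtain ⟨u, hu⟩ := exists_coe_eq_unitPart hx
  obtain ⟨t, ht, -⟩ := exists_tendsto_pow_prime_pow u
  have ht' : Tendsto (fun n : ℕ => (u * w) ^ p ^ n) atTop (𝓝 t) := by
    simpa only [mul_pow, mul_one] using ht.mul (tendsto_pow_prime_pow_one hw)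
  rw [angle, angle, hunit, ← hu, teich_coe ht, ← PadicInt.coe_mul, teich_coe ht',
    PadicInt.coe_mul]
  ring

lemma norm_angle_sub_one_le {x : ℚ_[p]} (hx : x ≠ 0) : ‖angle p x - 1‖ ≤ (p : ℝ)⁻¹ := by
  obtain ⟨u, hu⟩ := exists_coe_eq_unitPart hx
  obtain ⟨t, ht, htu⟩ := exists_tendsto_pow_prime_pow u
  have e := teich_coe ht
  rw [PadicInt.norm_def, PadicInt.coe_sub, hu] at htu
  rw [hu] at e
  have ht1 : ‖(t : ℚ_[p])‖ = 1 := by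
    refine (Padic.norm_eq_of_norm_add_lt_right (z2 := -unitPart p x) ?_).trans
      (by rw [norm_neg, norm_unitPart hx])
    rw [← sub_eq_add_neg, norm_neg, norm_unitPart hx]
    exact htu.trans_lt prime_inv_lt_one
  have ht0 : (t : ℚ_[p]) ≠ 0 := by
    rw [← norm_ne_zero_iff, ht1]
    exact one_ne_zero
  rw [angle, e, div_sub_one ht0, norm_div, ht1, div_one, norm_sub_rev]
  exact htu

lemma norm_angle {x : ℚ_[p]} (hx : x ≠ 0) : ‖angle p x‖ = 1 := by
  rw [← norm_one (α := ℚ_[p]), ← norm_neg (1 : ℚ_[p])]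
  refine Padic.norm_eq_of_norm_add_lt_right ?_
  rw [← sub_eq_add_neg, norm_neg, norm_one]
  exact (norm_angle_sub_one_le hx).trans_lt prime_inv_lt_one

end Angle

section Binomial

/-- The derivative of `s ↦ (1 - s)(-s)⋯(2 - s - n)`, the numerator of `C(1 - s, n)`. -/
noncomputable def gbinomNumDeriv (p : ℕ) [Fact p.Prime] : ℕ → ℤ_[p] → ℚ_[p]
  | 0, _ => 0
  | n + 1, s => gbinomNumDeriv p n s * (1 - (s : ℚ_[p]) - n) +
      (∏ i ∈ Finset.range n, (1 - (s : ℚ_[p]) - i)) * (-1)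

lemma c2Bound_gbinomNum (n : ℕ) :
    C2Bound (fun s : ℤ_[p] => ∏ i ∈ Finset.range n, (1 - (s : ℚ_[p]) - i))
      (gbinomNumDeriv p n) 1 := by
  induction n with
  | zero => simpa [gbinomNumDeriv, funext_iff] using C2Bound.const (p := p) 1
  | succ n ih =>
    have h1 : ‖(1 - n : ℚ_[p])‖ ≤ 1 := by exact_mod_cast Padic.norm_int_le_one (p := p) (1 - n)
    have h2 : C2Bound (fun s : ℤ_[p] => 1 - (s : ℚ_[p]) - n) (fun _ => -1) 1 := by
      convert ((C2Bound.const (1 - n : ℚ_[p])).mono h1).add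
        ((C2Bound.coe.const_mul (-1 : ℚ_[p])).mono (by simp)) using 2
      · ring
      · ring
    have h3 := ih.mul h2
    rw [mul_one] at h3
    simp only [Finset.prod_range_succ]
    exact h3

lemma prod_range_one_sub_eq_zero (n : ℕ) :
    ∏ i ∈ Finset.range (n + 2), ((1 : ℚ_[p]) - i) = 0 :=
  Finset.prod_eq_zero (i := 1) (by simp) (by simp)

lemma gbinomNumDeriv_add_two_zero (n : ℕ) :
    gbinomNumDeriv p (n + 2) 0 = -(-1) ^ n * n.factorial := by
  induction n with
  | zero => simp [gbinomNumDeriv]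
  | succ n ih =>
    rw [gbinomNumDeriv, ih]
    simp only [PadicInt.coe_zero, sub_zero, prod_range_one_sub_eq_zero, Nat.factorial_succ]
    push_cast
    ring

lemma tsum_gbinom_one_mul_pow (z : ℚ_[p]) : ∑' n, gbinom p 1 n * z ^ n = 1 + z := by
  rw [tsum_eq_sum (s := Finset.range 2)]
  · simp [Finset.sum_range_succ, gbinom]
  · intro n hn
    obtain ⟨m, rfl⟩ := Nat.exists_eq_add_of_le' (not_lt.1 (Finset.mem_range.not.1 hn))
    simp [gbinom, prod_range_one_sub_eq_zero]

lemma norm_inv_factorial_le (hp : Odd p) (n : ℕ) :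
    ‖(n.factorial : ℚ_[p])⁻¹‖ ≤ √p ^ n := by
  have hp1 : (1 : ℝ) ≤ p := by exact_mod_cast (Fact.out : p.Prime).one_lt.le
  have hp3 : 2 ≤ p - 1 := by
    have := (Fact.out : p.Prime).two_le
    obtain ⟨m, hm⟩ := hp
    omega
  have hv : 2 * padicValNat p n.factorial ≤ n := by
    calc _ ≤ (p - 1) * padicValNat p n.factorial := by gcongr
      _ ≤ n := by rw [sub_one_mul_padicValNat_factorial]; exact Nat.sub_le _ _
  have h0 : (n.factorial : ℚ_[p]) ≠ 0 := by exact_mod_cast n.factorial_ne_zero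
  rw [norm_inv, Padic.norm_eq_zpow_neg_valuation h0, Padic.valuation_natCast, zpow_neg, inv_inv,
    zpow_natCast]
  calc (p : ℝ) ^ padicValNat p n.factorial = √p ^ (2 * padicValNat p n.factorial) := by
        rw [pow_mul, Real.sq_sqrt (by positivity)]
    _ ≤ √p ^ n := pow_le_pow_right₀ (Real.one_le_sqrt.2 hp1) hv

lemma sqrt_inv_lt_one : (√(p : ℝ))⁻¹ < 1 :=
  inv_lt_one_of_one_lt₀ (Real.lt_sqrt_of_sq_lt
    (by rw [one_pow]; exact_mod_cast (Fact.out : p.Prime).one_lt))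

lemma mul_inv_pow_le {q c : ℝ} {n : ℕ} (hq : 0 ≤ q) (hc : c ≤ √q ^ n) :
    c * q⁻¹ ^ n ≤ (√q)⁻¹ ^ n := by
  have e : (√q)⁻¹ = √q * q⁻¹ := by rw [← div_eq_mul_inv, Real.sqrt_div_self]
  rw [e, mul_pow]
  gcongr

lemma tendsto_mul_inv_pow {c : ℕ → ℝ} (hc0 : ∀ n, 0 ≤ c n) (hc : ∀ n, c n ≤ √p ^ n) :
    Tendsto (fun n => c n * (p : ℝ)⁻¹ ^ n) atTop (𝓝 0) :=
  squeeze_zero (fun n => mul_nonneg (hc0 n) (by positivity)) (fun n => mul_inv_pow_le p.cast_nonneg (hc n))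
    (tendsto_pow_atTop_nhds_zero_of_lt_one (by positivity) sqrt_inv_lt_one)

lemma mul_inv_pow_le_one {c : ℝ} {n : ℕ} (hc : c ≤ √p ^ n) : c * (p : ℝ)⁻¹ ^ n ≤ 1 :=
  (mul_inv_pow_le p.cast_nonneg hc).trans (pow_le_one₀ (by positivity) sqrt_inv_lt_one.le)

lemma summable_mul_pow {c : ℕ → ℚ_[p]} (hc : ∀ n, ‖c n‖ ≤ √p ^ n) {z : ℚ_[p]}
    (hz : ‖z‖ ≤ (p : ℝ)⁻¹) : Summable fun n => c n * z ^ n := by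
  refine C2Bound.summable_of_norm_le (r := fun n => ‖c n‖ * (p : ℝ)⁻¹ ^ n)
    (fun n => norm_mul_le_of_le_of_le le_rfl ?_) ?_
  · rw [norm_pow]
    gcongr
  · rw [Nat.cofinite_eq_atTop]
    exact tendsto_mul_inv_pow (fun _ => norm_nonneg _) hc

lemma norm_div_factorial_le (hp : Odd p) {a : ℚ_[p]} (ha : ‖a‖ ≤ 1) (n : ℕ) :
    ‖a / n.factorial‖ ≤ √p ^ n := by
  rw [div_eq_mul_inv]
  simpa using norm_mul_le_of_le_of_le ha (norm_inv_factorial_le hp n)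

/-- The expansion of `(1 + z) log(1 + z)`, whose coefficients are the derivatives at `s = 0` of
`-C(1 - s, n)`. -/
lemma hasSum_one_add_mul_log (hp : Odd p) {z : ℚ_[p]} (hz : ‖z‖ ≤ (p : ℝ)⁻¹) :
    HasSum (fun n => -(gbinomNumDeriv p n 0 / n.factorial) * z ^ n)
      ((1 + z) * ∑' n : ℕ, (-1 : ℚ_[p]) ^ n * z ^ (n + 1) / ((n : ℚ_[p]) + 1)) := by
  set a : ℕ → ℚ_[p] := fun n => (-1 : ℚ_[p]) ^ n * z ^ (n + 1) / ((n : ℚ_[p]) + 1)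
  have hn (n : ℕ) : ((n : ℚ_[p]) + 1) ≠ 0 := by exact_mod_cast n.succ_ne_zero
  have hfac (n : ℕ) : (n.factorial : ℚ_[p]) ≠ 0 := by exact_mod_cast n.factorial_ne_zero
  have hc (n : ℕ) : ‖(-((-1) ^ n * ((n - 1).factorial : ℚ_[p])) / n.factorial : ℚ_[p])‖ ≤
      √p ^ n := by
    refine norm_div_factorial_le hp ?_ n
    exact_mod_cast Padic.norm_int_le_one (p := p) (-((-1) ^ n * ((n - 1).factorial : ℤ)))
  have ha : HasSum a (∑' n, a n) := by
    refine Summable.hasSum ?_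
    refine ((summable_nat_add_iff 1).2 (summable_mul_pow hc hz)).congr fun n => ?_
    simp only [a, Nat.add_sub_cancel, Nat.factorial_succ]
    have := hn n
    have := hfac n
    push_cast
    field_simp
    ring
  have h1 := (hasSum_nat_add_iff' 1).2 ha
  have h2 := h1.add (ha.mul_left z)
  refine (hasSum_nat_add_iff' 2).1 ?_
  convert h2 using 1
  · funext n
    rw [gbinomNumDeriv_add_two_zero]
    simp only [a, Nat.factorial_succ]
    have := hn n
    have : (n : ℚ_[p]) + 1 + 1 ≠ 0 := by exact_mod_cast (n + 1).succ_ne_zero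
    have := hfac n
    push_cast
    field_simp
    ring
  · simp [Finset.sum_range_succ, gbinomNumDeriv, a]
    ring

end Binomial

section Zeta

lemma exists_angle_add_eq {f : ℤ_[p] → ℤ_[p]} (hf : EverywhereAnalytic p f) {lam : ℚ_[p]}
    (hlam : 1 < ‖lam‖) :
    ∃ z z' : ℤ_[p] → ℚ_[p], C2Bound z z' (p : ℝ)⁻¹ ∧
      ∀ a, angle p (lam + f a) = 1 + z a ∧ lam + f a = omegaV p lam * (1 + z a) := by
  have hlam0 : lam ≠ 0 := norm_pos_iff.1 (one_pos.trans hlam)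
  have hinv : ‖lam⁻¹‖ ≤ (p : ℝ)⁻¹ := norm_le_inv_of_lt_one (by
    rw [norm_inv]
    exact inv_lt_one_of_one_lt₀ hlam)
  have hA := norm_angle hlam0
  have hA0 : angle p lam ≠ 0 := by
    rw [← norm_ne_zero_iff, hA]
    exact one_ne_zero
  obtain ⟨f', hf'⟩ := hf.exists_c2Bound
  have h1 := (C2Bound.const (angle p lam - 1)).mono (norm_angle_sub_one_le hlam0)
  have h2 := (hf'.const_mul (angle p lam * lam⁻¹)).mono (s := (p : ℝ)⁻¹) (by
    rw [norm_mul, hA, one_mul, mul_one]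
    exact hinv)
  refine ⟨_, _, h1.add h2, fun a => ?_⟩
  obtain ⟨w, hw⟩ : ∃ w : ℤ_[p], (w : ℚ_[p]) = lam⁻¹ :=
    ⟨⟨lam⁻¹, hinv.trans (prime_inv_lt_one (p := p)).le⟩, rfl⟩
  have hdvd : (p : ℤ_[p]) ∣ (1 + w * f a) - 1 := by
    rw [add_sub_cancel_left]
    refine Dvd.dvd.mul_right ((PadicInt.norm_lt_one_iff_dvd _).1 ?_) _
    rw [PadicInt.norm_def, hw]
    exact hinv.trans_lt prime_inv_lt_one
  have hfac : lam + f a = lam * (1 + w * f a : ℤ_[p]) := by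
    push_cast
    rw [hw]
    field_simp
  constructor
  · rw [hfac, angle_mul hlam0 hdvd]
    push_cast
    rw [hw]
    ring
  · rw [omegaV]
    field_simp
    ring

lemma hasDerivAt_of_c2Bound {G : ℚ_[p] → ℚ_[p]} {g g' : ℤ_[p] → ℚ_[p]} {R : ℝ}
    (hg : C2Bound g g' R) (hG : ∀ s : ℤ_[p], G s = g s) : HasDerivAt G (g' 0) 0 := by
  rw [hasDerivAt_iff_isLittleO_nhds_zero]
  have hO : (fun h : ℚ_[p] => G (0 + h) - G 0 - h • g' 0) =O[𝓝 0] fun h => ‖h‖ ^ 2 := by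
    refine Asymptotics.IsBigO.of_bound R ?_
    filter_upwards [Metric.ball_mem_nhds (0 : ℚ_[p]) one_pos] with h hh
    obtain ⟨s, rfl⟩ : ∃ s : ℤ_[p], (s : ℚ_[p]) = h :=
      ⟨⟨h, (mem_ball_zero_iff.1 hh).le⟩, rfl⟩
    have h0 := hG 0
    rw [PadicInt.coe_zero] at h0
    rw [zero_add, h0, hG, smul_eq_mul, norm_pow, norm_norm]
    simpa using hg.norm_taylor_le 0 s
  exact hO.trans_isLittleO (Asymptotics.isLittleO_norm_pow_id one_lt_two)

end Zeta

end Calculus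

end PZeta

/-- the function `s ↦ ζ_p^f(s,λ)` is differentiable at `s = 0`, the
Volkenborn integral `∫_{ℤ_p} (λ+f(a))·(log_p(λ+f(a)) - 1) da` exists, and
`log Γ_p^f(λ) = ω_v(λ)·(d/ds ζ_p^f(s,λ))|_{s=0} = ∫_{ℤ_p} (λ+f(a))(log_p(λ+f(a)) - 1) da`. -/
theorem logGammaH_integral_representation (p : ℕ) [Fact p.Prime] (hp : Odd p)
    (f : ℤ_[p] → ℤ_[p]) (hf : EverywhereAnalytic p f) (lam : ℚ_[p]) (hlam : 1 < ‖lam‖) :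
    ∃ D L : ℚ_[p],
      HasDerivAt (fun s : ℚ_[p] =>
          (s - 1)⁻¹ *
            limUnder Filter.atTop
              (volkSum p fun a => bpow p (angle p (lam + (f a : ℚ_[p]))) (1 - s))) D 0 ∧
      Filter.Tendsto
        (volkSum p fun a =>
          (lam + (f a : ℚ_[p])) * (padicLog p (lam + (f a : ℚ_[p])) - 1))
        Filter.atTop (nhds L) ∧
      omegaV p lam * D = L := by
  obtain ⟨z, z', hz, hangle⟩ := exists_angle_add_eq hf hlam
  choose k' hk using hz.exists_pow
  choose V hV hVN using fun n => exists_volkSum_limit hp (hk n)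
  have hbinom (s : ℤ_[p]) (n : ℕ) : ‖gbinom p (1 - s) n‖ ≤ √p ^ n :=
    norm_div_factorial_le hp ((c2Bound_gbinomNum n).norm_le s) n
  have hder (n : ℕ) : ‖-(gbinomNumDeriv p n 0 / n.factorial)‖ ≤ √p ^ n := by
    rw [norm_neg]
    exact norm_div_factorial_le hp ((c2Bound_gbinomNum n).norm_deriv_le 0) n
  have hint (c : ℕ → ℚ_[p]) (hc : ∀ n, ‖c n‖ ≤ √p ^ n) :
      Tendsto (volkSum p fun a => ∑' n, c n * z a ^ n) atTop (𝓝 (∑' n, c n * V n)) :=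
    tendsto_volkSum_tsum hk (fun n N => hVN n N) hV c
      (tendsto_mul_inv_pow (fun _ => norm_nonneg _) hc) fun n => mul_inv_pow_le_one (hc n)
  set G : ℚ_[p] → ℚ_[p] := fun s => limUnder atTop
    (volkSum p fun a => bpow p (angle p (lam + (f a : ℚ_[p]))) (1 - s))
  have hG (s : ℤ_[p]) : G s = ∑' n, gbinom p (1 - s) n * V n := by
    refine Tendsto.limUnder_eq ?_
    simpa only [bpow, (hangle _).1, add_sub_cancel_left] using hint _ (hbinom s)
  have hG0 : G 0 = ∑' n, gbinom p 1 n * V n := by simpa using hG 0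
  have hbound (n : ℕ) : ‖V n / n.factorial‖ * 1 ≤ p * (√p)⁻¹ ^ n := by
    rw [mul_one, div_eq_mul_inv]
    calc _ ≤ (p : ℝ)⁻¹ ^ n * p * √p ^ n :=
          norm_mul_le_of_le_of_le (hV n) (norm_inv_factorial_le hp n)
      _ = p * (√p ^ n * (p : ℝ)⁻¹ ^ n) := by ring
      _ ≤ _ := by
        gcongr
        exact mul_inv_pow_le p.cast_nonneg le_rfl
  have hlim : Tendsto (fun n : ℕ => p * (√(p : ℝ))⁻¹ ^ n) atTop (𝓝 0) := by
    simpa using (tendsto_pow_atTop_nhds_zero_of_lt_one (by positivity)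
      (sqrt_inv_lt_one (p := p))).const_mul (p : ℝ)
  have hC2 := C2Bound.tsum (R := p)
    (fun n => ((c2Bound_gbinomNum (p := p) n).const_mul (V n / (n.factorial : ℚ_[p]))).mono (hbound n))
    hlim fun n => mul_le_of_le_one_right p.cast_nonneg
      (pow_le_one₀ (by positivity) (sqrt_inv_lt_one (p := p)).le)
  have hderiv := hasDerivAt_of_c2Bound hC2 fun s => (hG s).trans
    (tsum_congr fun n => by rw [gbinom]; ring)
  have hinv : HasDerivAt (fun s : ℚ_[p] => (s - 1)⁻¹) (-1) 0 := by
    simpa using ((hasDerivAt_id (0 : ℚ_[p])).sub_const 1).fun_inv (by simp)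
  refine ⟨-1 * G 0 + (0 - 1)⁻¹ * ∑' n, V n / (n.factorial : ℚ_[p]) * gbinomNumDeriv p n 0, _,
    hinv.mul hderiv, ?_, rfl⟩
  have hL := ((hint _ hder).sub (hint _ (by simpa using hbinom 0))).const_mul (omegaV p lam)
  convert hL using 1
  · funext N
    simp only [volkSum, ← mul_sub, ← Finset.sum_sub_distrib]
    rw [mul_left_comm, Finset.mul_sum _ _ (omegaV p lam)]
    congr 1
    refine Finset.sum_congr rfl fun a _ => ?_
    rw [tsum_gbinom_one_mul_pow, (hasSum_one_add_mul_log hp (hz.norm_le a)).tsum_eq, padicLog,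
      (hangle a).1, (hangle a).2, add_sub_cancel_left]
    ring
  · have e : ∑' n, -(gbinomNumDeriv p n 0 / (n.factorial : ℚ_[p])) * V n =
        -∑' n, V n / (n.factorial : ℚ_[p]) * gbinomNumDeriv p n 0 := by
      rw [← tsum_neg]
      exact tsum_congr fun n => by ring
    rw [e, hG0, zero_sub, inv_neg, inv_one]
    congr 2
    ring
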